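/- arXiv:1908.11616 — 6 statements merged into one kernel-verified Lean document; each statement's English description precedes it below -/
import Mathlib

section
/- Let Π be an n×n real symmetric matrix and let R be its Gauss tensor, R_{pijk} = Π_{pj}Π_{ik} − Π_{pk}Π_{ij}. If R has positive sectional values, then R is positive definite as a curvature operator. -/
open Matrix

/-- The Gauss tensor of a symmetric matrix `B`: `R p i j k = B p j * B i k - B p k * B i j`. -/
def gaussTensor {n : ℕ} (B : Matrix (Fin n) (Fin n) ℝ) :
    Fin n → Fin n → Fin n → Fin n → ℝ :=
  fun p i j k => B p j * B i k - B p k * B i j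

/-- Every real symmetric matrix is diagonalised by an orthogonal matrix. -/
theorem Matrix.IsSymm.exists_orthogonal_diagonal {ι : Type*} [Fintype ι] [DecidableEq ι]
    {B : Matrix ι ι ℝ} (hB : B.IsSymm) :
    ∃ (U : Matrix ι ι ℝ) (d : ι → ℝ),
      Uᵀ * U = 1 ∧ U * Uᵀ = 1 ∧ Uᵀ * B * U = diagonal d := by
  have hH : B.IsHermitian := by
    rw [Matrix.IsHermitian, conjTranspose_eq_transpose_of_trivial]
    exact hB
  have hs : (hH.eigenvectorUnitary : Matrix ι ι ℝ)ᵀ =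
      star (hH.eigenvectorUnitary : Matrix ι ι ℝ) := by
    rw [star_eq_conjTranspose, conjTranspose_eq_transpose_of_trivial]
  have h1 := Unitary.star_mul_self_of_mem hH.eigenvectorUnitary.2
  have h2 := Unitary.mul_star_self_of_mem hH.eigenvectorUnitary.2
  rw [← hs] at h1 h2
  refine ⟨hH.eigenvectorUnitary, hH.eigenvalues, h1, h2, ?_⟩
  have h := hH.spectral_theorem
  rw [Unitary.conjStarAlgAut_apply, ← hs] at h
  generalize (hH.eigenvectorUnitary : Matrix ι ι ℝ) = U at *
  calc Uᵀ * B * U = Uᵀ * (U * diagonal (RCLike.ofReal ∘ hH.eigenvalues) * Uᵀ) * U := by rw [← h]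
    _ = (Uᵀ * U) * diagonal (RCLike.ofReal ∘ hH.eigenvalues) * (Uᵀ * U) := by
      simp only [Matrix.mul_assoc]
    _ = diagonal hH.eigenvalues := by rw [h1, Matrix.one_mul, Matrix.mul_one]; rfl

theorem sum_gaussTensor_sectional {n : ℕ} (B : Matrix (Fin n) (Fin n) ℝ) (v w : Fin n → ℝ) :
    ∑ p, ∑ i, ∑ j, ∑ k, gaussTensor B p i j k * v p * w i * v j * w k =
      (v ⬝ᵥ B *ᵥ v) * (w ⬝ᵥ B *ᵥ w) - (v ⬝ᵥ B *ᵥ w) * (w ⬝ᵥ B *ᵥ v) := by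
  have h (a b c d : Fin n → ℝ) : (a ⬝ᵥ B *ᵥ b) * (c ⬝ᵥ B *ᵥ d) =
      ∑ p, ∑ i, ∑ j, ∑ k, (a p * (B p j * b j)) * (c i * (B i k * d k)) := by
    simp only [dotProduct, mulVec, Finset.sum_mul_sum]
    refine Finset.sum_congr rfl fun p _ => Finset.sum_congr rfl fun i _ => ?_
    rw [Finset.mul_sum, Finset.mul_sum, Finset.sum_mul_sum]
  rw [h, h]
  simp only [gaussTensor]
  have hswap (p i : Fin n) : ∑ j, ∑ k, (v p * (B p j * w j)) * (w i * (B i k * v k)) =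
      ∑ j, ∑ k, (v p * (B p k * w k)) * (w i * (B i j * v j)) := Finset.sum_comm
  simp only [hswap, ← Finset.sum_sub_distrib]
  refine Finset.sum_congr rfl fun p _ => Finset.sum_congr rfl fun i _ =>
    Finset.sum_congr rfl fun j _ => Finset.sum_congr rfl fun k _ => ?_
  ring

theorem sum_gaussTensor_skew {n : ℕ} {B : Matrix (Fin n) (Fin n) ℝ} (hB : B.IsSymm)
    {ω : Matrix (Fin n) (Fin n) ℝ} (hω : ωᵀ = -ω) :
    ∑ p, ∑ i, ∑ j, ∑ k, gaussTensor B p i j k * ω p i * ω j k =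
      2 * (B * ω * B * ωᵀ).trace := by
  have hs (j k : Fin n) : ω k j = -ω j k := congrFun (congrFun hω j) k
  have h1 : (B * ω * B * ωᵀ).trace = ∑ p, ∑ i, ∑ j, ∑ k, B p j * B i k * ω p i * ω j k := by
    simp only [trace, diag_apply, mul_apply, transpose_apply, Finset.sum_mul]
    calc ∑ j, ∑ k, ∑ i, ∑ p, B j p * ω p i * B i k * ω j k
        = ∑ j, ∑ k, ∑ p, ∑ i, B j p * ω p i * B i k * ω j k := by
          exact Finset.sum_congr rfl fun j _ => Finset.sum_congr rfl fun k _ => Finset.sum_comm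
      _ = ∑ j, ∑ p, ∑ i, ∑ k, B j p * ω p i * B i k * ω j k := by
          refine Finset.sum_congr rfl fun j _ => ?_
          rw [Finset.sum_comm]
          exact Finset.sum_congr rfl fun p _ => Finset.sum_comm
      _ = ∑ p, ∑ i, ∑ j, ∑ k, B j p * ω p i * B i k * ω j k := by
          rw [Finset.sum_comm]
          exact Finset.sum_congr rfl fun p _ => Finset.sum_comm
      _ = _ := by
          refine Finset.sum_congr rfl fun p _ => Finset.sum_congr rfl fun i _ =>
            Finset.sum_congr rfl fun j _ => Finset.sum_congr rfl fun k _ => ?_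
          rw [hB.apply p j]
          ring
  have h2 (p i : Fin n) : ∑ j, ∑ k, B p k * B i j * ω p i * ω j k =
      -∑ j, ∑ k, B p j * B i k * ω p i * ω j k := by
    rw [Finset.sum_comm]
    simp only [← Finset.sum_neg_distrib]
    refine Finset.sum_congr rfl fun j _ => Finset.sum_congr rfl fun k _ => ?_
    rw [hs j k]
    ring
  simp only [gaussTensor, sub_mul, Finset.sum_sub_distrib, h2, h1, Finset.sum_neg_distrib]
  ring

theorem Matrix.trace_diagonal_mul_mul_diagonal_mul_transpose {ι : Type*} [Fintype ι]
    [DecidableEq ι] (d : ι → ℝ) (M : Matrix ι ι ℝ) :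
    (diagonal d * M * diagonal d * Mᵀ).trace = ∑ a, ∑ b, d a * d b * M a b ^ 2 := by
  simp only [trace, diag_apply, mul_apply (N := Mᵀ), mul_diagonal, diagonal_mul, transpose_apply]
  refine Finset.sum_congr rfl fun a _ => Finset.sum_congr rfl fun b _ => ?_
  ring

/-- If the Gauss tensor of a symmetric matrix `B` has positive sectional
values (i.e. `∑ R_{pijk} v_p w_i v_j w_k > 0` for all linearly independent `v, w`), then it
is positive definite as a curvature operator
(i.e. `∑ R_{pijk} ω_{pi} ω_{jk} > 0` for every nonzero skew-symmetric `ω`). -/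
theorem stmt_1 {n : ℕ} (B : Matrix (Fin n) (Fin n) ℝ) (hB : B.IsSymm)
    (hsec : ∀ v w : Fin n → ℝ, LinearIndependent ℝ ![v, w] →
      0 < ∑ p, ∑ i, ∑ j, ∑ k, gaussTensor B p i j k * v p * w i * v j * w k) :
    ∀ ω : Matrix (Fin n) (Fin n) ℝ, ω ≠ 0 → ωᵀ = -ω →
      0 < ∑ p, ∑ i, ∑ j, ∑ k, gaussTensor B p i j k * ω p i * ω j k := by
  intro ω hω0 hω
  obtain ⟨U, d, h1, h2, hd⟩ := hB.exists_orthogonal_diagonal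
  have hentry (a b : Fin n) : U.col a ⬝ᵥ B *ᵥ U.col b = diagonal d a b := by
    rw [← hd, Matrix.mul_assoc, mul_apply]
    rfl
  have hpos (a b : Fin n) (hab : a ≠ b) : 0 < d a * d b := by
    have hU : IsUnit U := IsUnit.of_mul_eq_one Uᵀ h2
    have hinj : Function.Injective ![a, b] := by
      intro x y
      fin_cases x <;> fin_cases y <;> simp [hab, hab.symm]
    have hli : LinearIndependent ℝ ![U.col a, U.col b] := by
      have hcols : ![U.col a, U.col b] = U.col ∘ ![a, b] := by
        ext x
        fin_cases x <;> rfl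
      rw [hcols]
      exact (linearIndependent_cols_of_isUnit hU).comp ![a, b] hinj
    have h := hsec _ _ hli
    rw [sum_gaussTensor_sectional] at h
    simpa [hentry, hab, hab.symm] using h
  set M := Uᵀ * ω * U with hM
  have hMω : U * M * Uᵀ = ω := by
    calc U * M * Uᵀ = (U * Uᵀ) * ω * (U * Uᵀ) := by simp only [hM, Matrix.mul_assoc]
      _ = ω := by rw [h2, Matrix.one_mul, Matrix.mul_one]
  have hBd : B = U * diagonal d * Uᵀ := by
    calc B = (U * Uᵀ) * B * (U * Uᵀ) := by rw [h2, Matrix.one_mul, Matrix.mul_one]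
      _ = U * diagonal d * Uᵀ := by simp only [← hd, Matrix.mul_assoc]
  have hMskew : Mᵀ = -M := by
    simp [hM, transpose_mul, hω, Matrix.mul_assoc]
  have hMdiag (a : Fin n) : M a a = 0 := by
    have h : M a a = -M a a := congrFun (congrFun hMskew a) a
    linarith
  have htrace : (B * ω * B * ωᵀ).trace = (diagonal d * M * diagonal d * Mᵀ).trace := by
    have hc (X : Matrix (Fin n) (Fin n) ℝ) : Uᵀ * (U * X) = X := by
      rw [← Matrix.mul_assoc, h1, Matrix.one_mul]
    rw [hBd, ← hMω]
    simp only [transpose_mul, transpose_transpose, Matrix.mul_assoc, hc]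
    rw [trace_mul_comm]
    simp only [Matrix.mul_assoc, h1, Matrix.mul_one]
  rw [sum_gaussTensor_skew hB hω, htrace, trace_diagonal_mul_mul_diagonal_mul_transpose]
  have hnonneg (a b : Fin n) : 0 ≤ d a * d b * M a b ^ 2 := by
    rcases eq_or_ne a b with rfl | hab
    · simp [hMdiag]
    · exact mul_nonneg (hpos a b hab).le (sq_nonneg _)
  obtain ⟨a, b, hab⟩ : ∃ a b, M a b ≠ 0 := by
    by_contra! h
    have hM0 : M = 0 := Matrix.ext h
    exact hω0 (by rw [← hMω, hM0, Matrix.mul_zero, Matrix.zero_mul])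
  have hne : a ≠ b := by
    rintro rfl
    exact hab (hMdiag a)
  refine mul_pos two_pos (Finset.sum_pos' (fun a _ => Finset.sum_nonneg fun b _ => hnonneg a b)
    ⟨a, Finset.mem_univ a, Finset.sum_pos' (fun b _ => hnonneg a b)
      ⟨b, Finset.mem_univ b, mul_pos (hpos a b hne) (by positivity)⟩⟩)
end

section
/- Let n ≥ 2 and let Π be an n×n real symmetric matrix whose Gauss tensor is positive definite as a curvature operator. Then either Π is positive definite or −Π is positive definite. -/
open Matrix

theorem sum_mul_mul_eq_dotProduct_mul_dotProduct {n : ℕ} (B : Matrix (Fin n) (Fin n) ℝ)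
    (u v w z : Fin n → ℝ) :
    ∑ p, ∑ i, ∑ j, ∑ k, B p j * B i k * (u p * v i * (w j * z k)) =
      (u ⬝ᵥ B *ᵥ w) * (v ⬝ᵥ B *ᵥ z) := by
  simp only [dotProduct, mulVec]
  rw [Finset.sum_mul_sum]
  refine Finset.sum_congr rfl fun p _ => Finset.sum_congr rfl fun i _ => ?_
  rw [mul_mul_mul_comm, Finset.sum_mul_sum]
  simp only [Finset.mul_sum]
  refine Finset.sum_congr rfl fun j _ => Finset.sum_congr rfl fun k _ => ?_
  ring

theorem sum_mul_mul_swap_eq_dotProduct_mul_dotProduct {n : ℕ} (B : Matrix (Fin n) (Fin n) ℝ)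
    (u v w z : Fin n → ℝ) :
    ∑ p, ∑ i, ∑ j, ∑ k, B p k * B i j * (u p * v i * (w j * z k)) =
      (u ⬝ᵥ B *ᵥ z) * (v ⬝ᵥ B *ᵥ w) := by
  rw [← sum_mul_mul_eq_dotProduct_mul_dotProduct]
  refine Finset.sum_congr rfl fun p _ => Finset.sum_congr rfl fun i _ => ?_
  rw [Finset.sum_comm]
  refine Finset.sum_congr rfl fun k _ => Finset.sum_congr rfl fun j _ => ?_
  ring

theorem dotProduct_mulVec_comm_of_isSymm {n : ℕ} {B : Matrix (Fin n) (Fin n) ℝ} (hB : B.IsSymm)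
    (x y : Fin n → ℝ) : y ⬝ᵥ B *ᵥ x = x ⬝ᵥ B *ᵥ y := by
  rw [dotProduct_mulVec, ← mulVec_transpose, hB.eq, dotProduct_comm]

/-- On a decomposable two-form `x ∧ y`, the Gauss tensor is four times the Gram determinant. -/
theorem sum_gaussTensor_wedge {n : ℕ} {B : Matrix (Fin n) (Fin n) ℝ} (hB : B.IsSymm)
    (x y : Fin n → ℝ) :
    ∑ p, ∑ i, ∑ j, ∑ k, gaussTensor B p i j k *
        (vecMulVec x y - vecMulVec y x) p i * (vecMulVec x y - vecMulVec y x) j k =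
      4 * ((x ⬝ᵥ B *ᵥ x) * (y ⬝ᵥ B *ᵥ y) - (x ⬝ᵥ B *ᵥ y) ^ 2) := by
  have expand (p i j k : Fin n) : gaussTensor B p i j k *
        (vecMulVec x y - vecMulVec y x) p i * (vecMulVec x y - vecMulVec y x) j k =
      B p j * B i k * (x p * y i * (x j * y k)) - B p j * B i k * (x p * y i * (y j * x k))
      - B p j * B i k * (y p * x i * (x j * y k)) + B p j * B i k * (y p * x i * (y j * x k))
      - B p k * B i j * (x p * y i * (x j * y k)) + B p k * B i j * (x p * y i * (y j * x k))
      + B p k * B i j * (y p * x i * (x j * y k)) - B p k * B i j * (y p * x i * (y j * x k)) := by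
    simp only [gaussTensor, Matrix.sub_apply, vecMulVec_apply]
    ring
  simp only [expand, Finset.sum_add_distrib, Finset.sum_sub_distrib,
    sum_mul_mul_eq_dotProduct_mul_dotProduct, sum_mul_mul_swap_eq_dotProduct_mul_dotProduct,
    dotProduct_mulVec_comm_of_isSymm hB x y]
  ring

/-- For `n ≥ 2`, if the Gauss tensor of a symmetric matrix `B` is positive
definite as a curvature operator (`∑ R_{pijk} ω_{pi} ω_{jk} > 0` for every nonzero
skew-symmetric `ω`), then either `B` or `-B` is positive definite. -/
theorem stmt_3 {n : ℕ} (hn : 2 ≤ n) (B : Matrix (Fin n) (Fin n) ℝ) (hB : B.IsSymm)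
    (hpos : ∀ ω : Matrix (Fin n) (Fin n) ℝ, ω ≠ 0 → ωᵀ = -ω →
      0 < ∑ p, ∑ i, ∑ j, ∑ k, gaussTensor B p i j k * ω p i * ω j k) :
    B.PosDef ∨ (-B).PosDef := by
  have gram_pos (x y : Fin n → ℝ) (h : vecMulVec x y - vecMulVec y x ≠ 0) :
      0 < (x ⬝ᵥ B *ᵥ x) * (y ⬝ᵥ B *ᵥ y) := by
    have h4 := hpos _ h (by simp [transpose_sub, transpose_vecMulVec])
    rw [sum_gaussTensor_wedge hB] at h4
    nlinarith [sq_nonneg (x ⬝ᵥ B *ᵥ y)]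
  let a : Fin n := ⟨0, by omega⟩
  let b : Fin n := ⟨1, by omega⟩
  have hab : b ≠ a := by simp [a, b]
  let e : Fin n → ℝ := Pi.single a 1
  have he : e ⬝ᵥ B *ᵥ e ≠ 0 := by
    refine right_ne_zero_of_mul (gram_pos (Pi.single b 1) e fun h => ?_).ne'
    have := congrFun (congrFun h b) a
    simp [e, vecMulVec_apply, hab, hab.symm] at this
  have same_sign (x : Fin n → ℝ) (hx : x ≠ 0) : 0 < (x ⬝ᵥ B *ᵥ x) * (e ⬝ᵥ B *ᵥ e) := by
    by_cases h : vecMulVec x e - vecMulVec e x = 0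
    · have hxe : x = x a • e := by
        ext p
        have := congrFun (congrFun h p) a
        simp [e, vecMulVec_apply] at this
        simp [e]
        linarith
      have hc : x a ≠ 0 := fun h0 => hx (by rw [hxe, h0, zero_smul])
      have hq : x ⬝ᵥ B *ᵥ x = x a ^ 2 * (e ⬝ᵥ B *ᵥ e) := by
        conv_lhs => rw [hxe]
        simp only [mulVec_smul, dotProduct_smul, smul_dotProduct, smul_eq_mul]
        ring
      rw [hq, mul_assoc]
      exact mul_pos (by positivity) (mul_self_pos.2 he)
    · exact gram_pos x e h
  have hH : B.IsHermitian := by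
    rw [IsHermitian, conjTranspose_eq_transpose_of_trivial, hB.eq]
  rcases he.lt_or_gt with hneg | hpos'
  · refine .inr (PosDef.of_dotProduct_mulVec_pos hH.neg fun x hx => ?_)
    have := neg_of_mul_pos_left (same_sign x hx) hneg.le
    simpa [neg_mulVec] using this
  · refine .inl (PosDef.of_dotProduct_mulVec_pos hH fun x hx => ?_)
    simpa using pos_of_mul_pos_left (same_sign x hx) hpos'.le
end

section
/- Let n ≥ 3 and let Π₁, Π₂ be n×n real symmetric positive definite matrices whose Gauss tensors coincide, i.e. (Π₁)_{pj}(Π₁)_{ik} − (Π₁)_{pk}(Π₁)_{ij} = (Π₂)_{pj}(Π₂)_{ik} − (Π₂)_{pk}(Π₂)_{ij} for all indices p, i, j, k. Then Π₁ = Π₂. -/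
open Matrix

/-- A positive definite `3 × 3` real matrix is determined by its adjugate. -/
theorem Matrix.PosDef.eq_of_adjugate_eq_fin_three {A B : Matrix (Fin 3) (Fin 3) ℝ}
    (hA : A.PosDef) (hB : B.PosDef) (h : A.adjugate = B.adjugate) : A = B := by
  have hdet : A.det = B.det := by
    have hsq : A.det ^ 2 = B.det ^ 2 := by
      simpa [det_adjugate] using congrArg det h
    exact (pow_left_inj₀ hA.det_pos.le hB.det_pos.le two_ne_zero).mp hsq
  have hadj : A.det • A = B.det • B := by
    simpa [adjugate_adjugate] using congrArg adjugate h
  rw [← hdet] at hadj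
  exact smul_right_injective _ hA.det_pos.ne' hadj

/-- Matrices with the same Gauss tensor have `3 × 3` submatrices with the same adjugate. -/
theorem adjugate_submatrix_eq_of_gaussTensor_eq {n : ℕ} {A B : Matrix (Fin n) (Fin n) ℝ}
    (h : gaussTensor A = gaussTensor B) (e f : Fin 3 → Fin n) :
    (A.submatrix e f).adjugate = (B.submatrix e f).adjugate := by
  have key (p i j k : Fin n) : A p j * A i k - A p k * A i j = B p j * B i k - B p k * B i j :=
    congrFun (congrFun (congrFun (congrFun h p) i) j) k
  ext a b
  fin_cases a <;> fin_cases b <;> simp [adjugate_fin_three] <;> grind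

/-- For `n ≥ 3`, two symmetric positive definite `n × n` real matrices
with the same Gauss tensor are equal. -/
theorem stmt_4 {n : ℕ} (hn : 3 ≤ n) (B₁ B₂ : Matrix (Fin n) (Fin n) ℝ)
    (h₁ : B₁.IsSymm) (h₂ : B₂.IsSymm) (hpd₁ : B₁.PosDef) (hpd₂ : B₂.PosDef)
    (heq : gaussTensor B₁ = gaussTensor B₂) :
    B₁ = B₂ := by
  ext i j
  obtain ⟨s, hs, hcard⟩ := Finset.exists_superset_card_eq
    (s := {i, j}) (n := 3) (Finset.card_le_two.trans (by norm_num)) (by simpa using hn)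
  let e := s.orderEmbOfFin hcard
  have mem_range (x : Fin n) (hx : x ∈ s) : ∃ a, e a = x := by
    have : x ∈ Set.range e := by simpa [e] using hx
    exact this
  obtain ⟨a, rfl⟩ := mem_range i (hs (by simp))
  obtain ⟨b, rfl⟩ := mem_range j (hs (by simp))
  have hsub := Matrix.PosDef.eq_of_adjugate_eq_fin_three
    (hpd₁.submatrix e.injective) (hpd₂.submatrix e.injective)
    (adjugate_submatrix_eq_of_gaussTensor_eq heq e e)
  exact congrFun (congrFun hsub a) b
end

section
/- Let n ≥ 3 and let Π₁, Π₂ be n×n real symmetric matrices whose Gauss tensors coincide, and suppose the curvature operator of this common Gauss tensor has rank at least 2 (as a linear map on skew-symmetric n×n matrices). Then Π₂ = Π₁ or Π₂ = −Π₁. -/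
open Matrix

/-- The curvature operator of a 4-index array `R` (antisymmetric in its last two indices):
it sends a skew-symmetric matrix `ω` to the matrix with `(p,i)` entry
`(1/2) * ∑ j k, R p i j k * ω j k`. -/
noncomputable def curvOp {n : ℕ} (R : Fin n → Fin n → Fin n → Fin n → ℝ)
    (ω : Matrix (Fin n) (Fin n) ℝ) : Matrix (Fin n) (Fin n) ℝ :=
  fun p i => (1 / 2) * ∑ j, ∑ k, R p i j k * ω j k

lemma sum_gaussTensor_mul {n : ℕ} (A : Matrix (Fin n) (Fin n) ℝ) (x y : Fin n → ℝ)
    (p i : Fin n) :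
    ∑ j, ∑ k, gaussTensor A p i j k * (x j * y k) =
      (A *ᵥ x) p * (A *ᵥ y) i - (A *ᵥ y) p * (A *ᵥ x) i := by
  rw [mul_comm ((A *ᵥ y) p)]
  simp only [gaussTensor, mulVec, dotProduct, Finset.sum_mul_sum]
  rw [← Finset.sum_sub_distrib]
  refine Finset.sum_congr rfl fun j _ => ?_
  rw [← Finset.sum_sub_distrib]
  exact Finset.sum_congr rfl fun k _ => by ring

lemma curvOp_gaussTensor {n : ℕ} (A ω : Matrix (Fin n) (Fin n) ℝ) (hω : ωᵀ = -ω) :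
    curvOp (gaussTensor A) ω = A * ω * Aᵀ := by
  have hskew (j k : Fin n) : ω k j = -ω j k := congrFun₂ hω j k
  ext p i
  have h1 : (A * ω * Aᵀ) p i = ∑ j, ∑ k, A p j * A i k * ω j k := by
    simp only [mul_apply, transpose_apply, Finset.sum_mul]
    rw [Finset.sum_comm]
    exact Finset.sum_congr rfl fun j _ => Finset.sum_congr rfl fun k _ => by ring
  have h2 : ∑ j, ∑ k, A p k * A i j * ω j k = -∑ j, ∑ k, A p j * A i k * ω j k := by
    rw [Finset.sum_comm]
    simp only [← Finset.sum_neg_distrib]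
    exact Finset.sum_congr rfl fun j _ => Finset.sum_congr rfl fun k _ => by
      rw [hskew]; ring
  have h3 : ∑ j, ∑ k, gaussTensor A p i j k * ω j k =
      ∑ j, ∑ k, A p j * A i k * ω j k - ∑ j, ∑ k, A p k * A i j * ω j k := by
    simp only [gaussTensor, sub_mul, Finset.sum_sub_distrib]
  rw [h1, curvOp, h3, h2]
  ring

/-- A linear map of rank at most `m` factors through `Fin m → K`. -/
lemma LinearMap.exists_eq_comp_of_finrank_range_le {K V W : Type*} [Field K] [AddCommGroup V]
    [Module K V] [AddCommGroup W] [Module K W] [FiniteDimensional K V] {m : ℕ}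
    (f : V →ₗ[K] W) (hf : Module.finrank K (LinearMap.range f) ≤ m) :
    ∃ (g : V →ₗ[K] (Fin m → K)) (h : (Fin m → K) →ₗ[K] W), f = h ∘ₗ g := by
  obtain ⟨i, hi⟩ : ∃ i : LinearMap.range f →ₗ[K] (Fin m → K), Function.Injective i :=
    Module.Free.exists_linearMap_injective_of_linearIndependent_of_lift_rank_le
      (Pi.basisFun K (Fin m)).linearIndependent (by
        rw [← Module.finrank_eq_rank, Cardinal.lift_natCast, Cardinal.mk_fin,
          Cardinal.lift_natCast]
        exact_mod_cast hf)
  obtain ⟨l, hl⟩ := LinearMap.exists_leftInverse_of_injective i (LinearMap.ker_eq_bot.2 hi)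
  refine ⟨i ∘ₗ f.rangeRestrict, (LinearMap.range f).subtype ∘ₗ l, ?_⟩
  ext x
  simpa using (congrArg Subtype.val (LinearMap.congr_fun hl (f.rangeRestrict x))).symm

/-- If `A = P * Q` has rank at most two, the matrices `A * ω * Aᵀ` with `ω` skew-symmetric are
pairwise proportional. -/
lemma not_linearIndependent_mul_skew_mul_transpose {n : ℕ} (P : Matrix (Fin n) (Fin 2) ℝ)
    (Q : Matrix (Fin 2) (Fin n) ℝ) (ω₁ ω₂ : Matrix (Fin n) (Fin n) ℝ) (h₁ : ω₁ᵀ = -ω₁)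
    (h₂ : ω₂ᵀ = -ω₂) :
    ¬ LinearIndependent ℝ ![P * Q * ω₁ * (P * Q)ᵀ, P * Q * ω₂ * (P * Q)ᵀ] := by
  have key (ω : Matrix (Fin n) (Fin n) ℝ) (h : ωᵀ = -ω) :
      ∃ c : ℝ, P * Q * ω * (P * Q)ᵀ =
        c • (P * (!![0, 1; -1, 0] : Matrix (Fin 2) (Fin 2) ℝ) * Pᵀ) := by
    have hS : (Q * ω * Qᵀ)ᵀ = -(Q * ω * Qᵀ) := by
      simp [transpose_mul, h, Matrix.mul_assoc]
    have hS' (a b : Fin 2) : (Q * ω * Qᵀ) b a = -(Q * ω * Qᵀ) a b := congrFun₂ hS a b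
    refine ⟨(Q * ω * Qᵀ) 0 1, ?_⟩
    have hc : Q * ω * Qᵀ = (Q * ω * Qᵀ) 0 1 • (!![0, 1; -1, 0] : Matrix (Fin 2) (Fin 2) ℝ) := by
      have h00 := hS' 0 0
      have h11 := hS' 1 1
      have h01 := hS' 0 1
      generalize Q * ω * Qᵀ = S at *
      ext a b
      fin_cases a <;> fin_cases b <;> simp <;> linarith
    calc P * Q * ω * (P * Q)ᵀ = P * (Q * ω * Qᵀ) * Pᵀ := by
          simp only [transpose_mul, Matrix.mul_assoc]
      _ = _ := by
        conv_lhs => rw [hc]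
        rw [Matrix.mul_smul, Matrix.smul_mul]
  obtain ⟨c, hc⟩ := key ω₁ h₁
  obtain ⟨d, hd⟩ := key ω₂ h₂
  rw [hc, hd]
  intro hli
  have h := LinearIndependent.pair_iff.1 hli d (-c) (by
    rw [smul_smul, smul_smul, ← add_smul]
    simp [mul_comm])
  have h0 := hli.ne_zero 0
  have hc0 : c = 0 := neg_eq_zero.1 h.2
  simp [hc0] at h0

lemma three_le_rank_of_linearIndependent_curvOp {n : ℕ} (A ω₁ ω₂ : Matrix (Fin n) (Fin n) ℝ)
    (h₁ : ω₁ᵀ = -ω₁) (h₂ : ω₂ᵀ = -ω₂)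
    (h : LinearIndependent ℝ ![curvOp (gaussTensor A) ω₁, curvOp (gaussTensor A) ω₂]) :
    3 ≤ A.rank := by
  by_contra! hlt
  obtain ⟨g, k, hgk⟩ := LinearMap.exists_eq_comp_of_finrank_range_le (m := 2) A.mulVecLin
    (Nat.le_of_lt_succ hlt)
  have hA : A = LinearMap.toMatrix' k * LinearMap.toMatrix' g := by
    rw [← LinearMap.toMatrix'_comp, ← hgk, ← Matrix.toLin'_apply', LinearMap.toMatrix'_toLin']
  rw [curvOp_gaussTensor A ω₁ h₁, curvOp_gaussTensor A ω₂ h₂, hA] at h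
  exact not_linearIndependent_mul_skew_mul_transpose _ _ ω₁ ω₂ h₁ h₂ h

/-- Linearly independent vectors admit a dual family of linear functionals. -/
lemma LinearIndependent.exists_dual_family {K V ι : Type*} [Field K] [AddCommGroup V]
    [Module K V] [Fintype ι] [DecidableEq ι] {u : ι → V} (hu : LinearIndependent K u) :
    ∃ φ : ι → V →ₗ[K] K, ∀ i j, φ i (u j) = (1 : Matrix ι ι K) i j := by
  obtain ⟨g, hg⟩ := LinearMap.exists_leftInverse_of_injective (Fintype.linearCombination K u)
    (LinearMap.ker_eq_bot.2 (linearIndependent_iff_injective_fintypeLinearCombination.1 hu))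
  refine ⟨fun i => LinearMap.proj i ∘ₗ g, fun i j => ?_⟩
  have h := congrFun (LinearMap.congr_fun hg (Pi.single j 1)) i
  simpa [Fintype.linearCombination_apply_single, Matrix.one_apply, Pi.single_apply] using h

/-- Three linearly independent vectors are determined up to a common sign by their pairwise
wedge products. -/
lemma exists_sq_eq_one_and_eq_smul_of_wedge_eq {V : Type*} [AddCommGroup V] [Module ℝ V]
    {u v : Fin 3 → V} (hu : LinearIndependent ℝ u)
    (h : ∀ (φ : V →ₗ[ℝ] ℝ) (a b : Fin 3),
      φ (u a) • u b - φ (u b) • u a = φ (v a) • v b - φ (v b) • v a) :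
    ∃ d : ℝ, d * d = 1 ∧ ∀ a, u a = d • v a := by
  obtain ⟨φ, hφ⟩ := hu.exists_dual_family
  let M : Matrix (Fin 3) (Fin 3) ℝ := Matrix.of fun i a => φ i (v a)
  have hM (i a : Fin 3) : φ i (v a) = M i a := rfl
  have hminor (i j a b : Fin 3) : M i a * M j b - M i b * M j a =
      (1 : Matrix (Fin 3) (Fin 3) ℝ) i a * (1 : Matrix (Fin 3) (Fin 3) ℝ) j b -
        (1 : Matrix (Fin 3) (Fin 3) ℝ) i b * (1 : Matrix (Fin 3) (Fin 3) ℝ) j a := by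
    have := congrArg (φ j) (h (φ i) a b)
    simpa [hφ, hM] using this.symm
  have hadj : M.adjugate = 1 := by
    rw [adjugate_fin_three]
    ext r s
    fin_cases r <;> fin_cases s <;> simp <;> grind [Matrix.one_apply]
  have hdet : M.det * M.det = 1 := by
    simpa [hadj, sq] using (det_adjugate M).symm
  have hMd : M = M.det • 1 := by
    simpa [hadj] using mul_adjugate M
  have hMv (i a : Fin 3) : φ i (v a) = M.det * (1 : Matrix (Fin 3) (Fin 3) ℝ) i a :=
    congrFun₂ hMd i a
  refine ⟨M.det, hdet, fun a => ?_⟩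
  obtain ⟨i, hi⟩ : ∃ i : Fin 3, i ≠ a := exists_ne a
  simpa [hφ, hMv, hi] using h (φ i) i a

/-- For `n ≥ 3`, if two symmetric matrices `B₁, B₂` have the same Gauss
tensor and the curvature operator of this common Gauss tensor has rank at least `2` as a
linear map on skew-symmetric matrices (i.e. there are two skew-symmetric matrices whose
images are linearly independent), then `B₂ = B₁` or `B₂ = -B₁`. -/
theorem stmt_5 {n : ℕ} (hn : 3 ≤ n) (B₁ B₂ : Matrix (Fin n) (Fin n) ℝ)
    (h₁ : B₁.IsSymm) (h₂ : B₂.IsSymm)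
    (heq : gaussTensor B₁ = gaussTensor B₂)
    (hrank : ∃ ω₁ ω₂ : Matrix (Fin n) (Fin n) ℝ, ω₁ᵀ = -ω₁ ∧ ω₂ᵀ = -ω₂ ∧
      LinearIndependent ℝ ![curvOp (gaussTensor B₁) ω₁, curvOp (gaussTensor B₁) ω₂]) :
    B₂ = B₁ ∨ B₂ = -B₁ := by
  obtain ⟨ω₁, ω₂, hω₁, hω₂, hli⟩ := hrank
  have hr := three_le_rank_of_linearIndependent_curvOp B₁ ω₁ ω₂ hω₁ hω₂ hli
  have hwedge (φ : (Fin n → ℝ) →ₗ[ℝ] ℝ) (x y : Fin n → ℝ) :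
      φ (B₁ *ᵥ x) • B₁ *ᵥ y - φ (B₁ *ᵥ y) • B₁ *ᵥ x =
        φ (B₂ *ᵥ x) • B₂ *ᵥ y - φ (B₂ *ᵥ y) • B₂ *ᵥ x := by
    ext i
    have hvec : (B₁ *ᵥ y) i • B₁ *ᵥ x - (B₁ *ᵥ x) i • B₁ *ᵥ y =
        (B₂ *ᵥ y) i • B₂ *ᵥ x - (B₂ *ᵥ x) i • B₂ *ᵥ y := by
      ext p
      have h := sum_gaussTensor_mul B₁ x y p i
      rw [heq, sum_gaussTensor_mul] at h
      simp only [Pi.sub_apply, Pi.smul_apply, smul_eq_mul]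
      linarith
    have h := congrArg φ hvec
    simp only [map_sub, map_smul, smul_eq_mul] at h
    simp only [Pi.sub_apply, Pi.smul_apply, smul_eq_mul]
    linarith
  obtain ⟨u, hu⟩ : ∃ u : Fin 3 → LinearMap.range B₁.mulVecLin, LinearIndependent ℝ u :=
    exists_linearIndependent_of_le_finrank hr
  choose x hx using fun a => (u a).2
  have hux : LinearIndependent ℝ fun a => B₁ *ᵥ x a := by
    have hxu : (fun a => B₁ *ᵥ x a) = (LinearMap.range B₁.mulVecLin).subtype ∘ u := funext hx
    rw [hxu]
    exact hu.map' _ (Submodule.ker_subtype _)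
  obtain ⟨d, hd, hdx⟩ := exists_sq_eq_one_and_eq_smul_of_wedge_eq (v := fun a => B₂ *ᵥ x a) hux
    fun φ a b => hwedge φ (x a) (x b)
  obtain ⟨φ, hφ⟩ := hux.exists_dual_family
  have hB₂x (a : Fin 3) : B₂ *ᵥ x a = d • B₁ *ᵥ x a := by
    rw [hdx a, smul_smul, hd, one_smul]
  have hmul (y : Fin n → ℝ) : B₂ *ᵥ y = d • B₁ *ᵥ y := by
    have e0 := hwedge (φ 0) (x 0) y
    have e1 := congrArg (φ 0) (hwedge (φ 1) (x 1) y)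
    simp only [hB₂x, map_smul, map_sub, hφ, smul_eq_mul] at e0 e1
    simp at e0 e1
    rw [e1, mul_comm d, mul_smul, sub_left_inj] at e0
    rw [e0, smul_smul, hd, one_smul]
  have hB : B₂ = d • B₁ := by
    refine Matrix.ext_of_mulVec_single fun i => ?_
    rw [hmul, Matrix.smul_mulVec]
  rcases mul_self_eq_one_iff.1 hd with rfl | rfl
  · exact Or.inl (by simpa using hB)
  · exact Or.inr (by simpa using hB)
end

section
/- Let n ≥ 3 and let Π be any n×n real symmetric matrix. Then its Gauss tensor cannot have negative sectional values everywhere: there exist linearly independent vectors v, w ∈ ℝⁿ such that (vᵀΠv)(wᵀΠw) − (vᵀΠw)² ≥ 0. -/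
theorem exists_ne_mul_nonneg {ι : Type*} (f : ι → ℝ) {a b c : ι}
    (hab : a ≠ b) (hac : a ≠ c) (hbc : b ≠ c) : ∃ i j, i ≠ j ∧ 0 ≤ f i * f j := by
  rcases le_total 0 (f a) with ha | ha <;> rcases le_total 0 (f b) with hb | hb <;>
    rcases le_total 0 (f c) with hc | hc <;>
    first
    | exact ⟨a, b, hab, mul_nonneg ha hb⟩
    | exact ⟨a, c, hac, mul_nonneg ha hc⟩
    | exact ⟨b, c, hbc, mul_nonneg hb hc⟩
    | exact ⟨a, b, hab, mul_nonneg_of_nonpos_of_nonpos ha hb⟩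
    | exact ⟨a, c, hac, mul_nonneg_of_nonpos_of_nonpos ha hc⟩
    | exact ⟨b, c, hbc, mul_nonneg_of_nonpos_of_nonpos hb hc⟩

open Matrix

/-- For `n ≥ 3` and any symmetric `n × n` real matrix `B`, the Gauss
tensor of `B` cannot have negative sectional values everywhere: there are linearly
independent `v, w` with `(vᵀBv)(wᵀBw) - (vᵀBw)² ≥ 0`. -/
theorem stmt_6 {n : ℕ} (hn : 3 ≤ n) (B : Matrix (Fin n) (Fin n) ℝ) (hB : B.IsSymm) :
    ∃ v w : Fin n → ℝ, LinearIndependent ℝ ![v, w] ∧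
      0 ≤ (v ⬝ᵥ B.mulVec v) * (w ⬝ᵥ B.mulVec w) - (v ⬝ᵥ B.mulVec w) ^ 2 := by
  have hH : B.IsHermitian := by
    rwa [Matrix.IsHermitian, conjTranspose_eq_transpose_of_trivial]
  obtain ⟨i, j, hij, hnonneg⟩ := exists_ne_mul_nonneg hH.eigenvalues
    (a := ⟨0, by omega⟩) (b := ⟨1, by omega⟩) (c := ⟨2, by omega⟩) (by simp) (by simp) (by simp)
  have hdot (k l : Fin n) : (hH.eigenvectorBasis k : Fin n → ℝ) ⬝ᵥ hH.eigenvectorBasis l =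
      if k = l then 1 else 0 := by
    rw [← orthonormal_iff_ite.mp hH.eigenvectorBasis.orthonormal k l,
      EuclideanSpace.inner_eq_star_dotProduct, star_trivial, dotProduct_comm]
  refine ⟨hH.eigenvectorBasis i, hH.eigenvectorBasis j, ?_, ?_⟩
  · rw [LinearIndependent.pair_iff]
    intro s t hst
    have hi := congrArg (fun u => (hH.eigenvectorBasis i : Fin n → ℝ) ⬝ᵥ u) hst
    have hj := congrArg (fun u => (hH.eigenvectorBasis j : Fin n → ℝ) ⬝ᵥ u) hst
    simp only [dotProduct_add, dotProduct_smul, hdot, dotProduct_zero] at hi hj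
    simpa [hij, hij.symm] using And.intro hi hj
  · simpa [hH.mulVec_eigenvectorBasis, dotProduct_smul, hdot, hij] using hnonneg
end

section
/- Let n > 3, let Π be an invertible n×n real symmetric matrix, and let D be a real 3-index array on ℝⁿ symmetric in its first two indices (D_{abc} = D_{bac} for all a, b, c). Define S_{abcde} := D_{ace}Π_{bd} + Π_{ac}D_{bde} − D_{ade}Π_{bc} − Π_{ad}D_{bce}. If the second-Bianchi-type sum vanishes, i.e. S_{abcde} + S_{abdec} + S_{abecd} = 0 for all indices a, b, c, d, e, then D is also symmetric in its last two indices: D_{abc} = D_{acb} for all a, b, c. -/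
open Matrix

section InverseContraction

variable {ι R : Type*} [Fintype ι] [DecidableEq ι] [CommRing R] {B C : Matrix ι ι R}

/-- Contracting the right index of `B x d * f b` with the inverse of `B`. -/
theorem sum_sum_inv_mul_right (hBC : B * C = 1) (hC : C.IsSymm) (f : ι → R) (x : ι) :
    ∑ b, ∑ d, C b d * (B x d * f b) = f x := by
  have h (b : ι) : ∑ d, C b d * (B x d * f b) = (1 : Matrix ι ι R) x b * f b := by
    rw [← hBC, Matrix.mul_apply, Finset.sum_mul]
    exact Finset.sum_congr rfl fun d _ => by rw [hC.apply d b]; ring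
  simp [h, Matrix.one_apply]

/-- Contracting the left index of `B b x * f d` with the inverse of `B`. -/
theorem sum_sum_inv_mul_left (hBC : B * C = 1) (hB : B.IsSymm) (f : ι → R) (x : ι) :
    ∑ b, ∑ d, C b d * (B b x * f d) = f x := by
  rw [Finset.sum_comm]
  have h (d : ι) : ∑ b, C b d * (B b x * f d) = (1 : Matrix ι ι R) x d * f d := by
    rw [← hBC, Matrix.mul_apply, Finset.sum_mul]
    exact Finset.sum_congr rfl fun b _ => by rw [hB.apply x b]; ring
  simp [h, Matrix.one_apply]

/-- The full contraction of `B` with its inverse is the dimension. -/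
theorem sum_sum_inv_mul_self (hBC : B * C = 1) (hC : C.IsSymm) (t : R) :
    ∑ b, ∑ d, C b d * (B b d * t) = Fintype.card ι * t := by
  have h (b : ι) : ∑ d, C b d * (B b d * t) = t := by
    calc
      ∑ d, C b d * (B b d * t) = (B * C) b b * t := by
        rw [Matrix.mul_apply, Finset.sum_mul]
        exact Finset.sum_congr rfl fun d _ => by rw [hC.apply d b]; ring
      _ = t := by rw [hBC, Matrix.one_apply_eq, one_mul]
  simp [h]

end InverseContraction

/-- Let `n > 3`, let `B` be an invertible symmetric `n × n` real matrix,
and let `D` be a 3-index array symmetric in its first two indices.  If the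
second-Bianchi-type sum of
`S a b c d e := D a c e * B b d + B a c * D b d e - D a d e * B b c - B a d * D b c e`
vanishes, i.e. `S a b c d e + S a b d e c + S a b e c d = 0` for all indices, then `D` is
also symmetric in its last two indices (the Codazzi equation). -/
theorem stmt_10 {n : ℕ} (hn : 3 < n) (B : Matrix (Fin n) (Fin n) ℝ)
    (hBsymm : B.IsSymm) (hBinv : IsUnit B.det)
    (D : Fin n → Fin n → Fin n → ℝ)
    (hDsymm : ∀ a b c, D a b c = D b a c)
    (hS : ∀ a b c d e : Fin n,
      (D a c e * B b d + B a c * D b d e - D a d e * B b c - B a d * D b c e)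
      + (D a d c * B b e + B a d * D b e c - D a e c * B b d - B a e * D b d c)
      + (D a e d * B b c + B a e * D b c d - D a c d * B b e - B a c * D b e d) = 0) :
    ∀ a b c, D a b c = D a c b := by
  set C := B⁻¹
  have hBC : B * C = 1 := B.mul_nonsing_inv hBinv
  have hC : C.IsSymm := by
    rw [Matrix.IsSymm, Matrix.transpose_nonsing_inv, hBsymm.eq]
  have hn' : (3 : ℝ) < n := by exact_mod_cast hn
  let T (a c e : Fin n) : ℝ := D a c e - D a e c
  have hT (a c e : Fin n) : T a e c = -T a c e := by simp only [T]; ring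
  let v (e : Fin n) : ℝ := ∑ b, ∑ d, C b d * T b d e
  have trace_bianchi (a c e : Fin n) : (n - 3) * T a c e + B a c * v e - B a e * v c = 0 := by
    have h : ∑ b, ∑ d, (C b d * (B b d * T a c e) + C b d * (B b c * T a e d)
        - C b d * (B b e * T a c d) + B a c * (C b d * T b d e)
        - C b d * (B a d * T b c e) - B a e * (C b d * T b d c)) = 0 := by
      refine Finset.sum_eq_zero fun b _ => Finset.sum_eq_zero fun d _ => ?_
      simp only [T]
      linear_combination C b d * hS a b c d e
    simp only [Finset.sum_add_distrib, Finset.sum_sub_distrib, ← Finset.mul_sum,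
      sum_sum_inv_mul_self hBC hC, sum_sum_inv_mul_left hBC hBsymm,
      sum_sum_inv_mul_right hBC hC (fun b => T b c e), Fintype.card_fin] at h
    linear_combination h - hT a c e
  have hv (e : Fin n) : v e = 0 := by
    have h : ∑ a, ∑ c, ((n - 3) * (C a c * T a c e) + C a c * (B a c * v e)
        - C a c * (B a e * v c)) = 0 := by
      refine Finset.sum_eq_zero fun a _ => Finset.sum_eq_zero fun c _ => ?_
      linear_combination C a c * trace_bianchi a c e
    simp only [Finset.sum_add_distrib, Finset.sum_sub_distrib, ← Finset.mul_sum,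
      sum_sum_inv_mul_self hBC hC, sum_sum_inv_mul_left hBC hBsymm, Fintype.card_fin] at h
    have h' : (2 * (n : ℝ) - 4) * v e = 0 := by linear_combination h
    exact (mul_eq_zero.mp h').resolve_left (by linarith)
  intro a b c
  have h := trace_bianchi a b c
  rw [hv, hv, mul_zero, mul_zero, add_zero, sub_zero] at h
  exact sub_eq_zero.mp ((mul_eq_zero.mp h).resolve_left (by linarith))
end
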